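/- Let n be a nonzero integer. Define q^+(n) to be the number of integer quadratic polynomials f(x) = ax^2 + bx + c with a(b^2 - 4ac) = n and b^2 - 4ac > 0, counted up to the substitution x ↦ x + t (t ∈ ℤ), and q_2(n) the number of such classes (without positivity) with b even. Then q_2(4n) = 2·q^+(n). -/

import Mathlib

/-- The superdiscriminant `I(f) = a*(b^2 - 4*a*c)` of the integer quadratic
polynomial `f(x) = a*x^2 + b*x + c`, encoded as the triple `(a, b, c)`. -/
def superdisc (p : ℤ × ℤ × ℤ) : ℤ := p.1 * (p.2.1 ^ 2 - 4 * p.1 * p.2.2)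

/-- Equivalence of integer quadratics under the substitution `x ↦ x + t`, `t ∈ ℤ`:
`a*(x+t)^2 + b*(x+t) + c = a*x^2 + (b + 2*a*t)*x + (a*t^2 + b*t + c)`. -/
def quadEquiv (p q : ℤ × ℤ × ℤ) : Prop :=
  ∃ t : ℤ, q = (p.1, p.2.1 + 2 * p.1 * t, p.1 * t ^ 2 + p.2.1 * t + p.2.2)

/-- The number of equivalence classes (under `x ↦ x + t`) of integer quadratics
with superdiscriminant `n` satisfying the extra condition `P`. -/
noncomputable def quadCount (n : ℤ) (P : ℤ × ℤ × ℤ → Prop) : ℕ :=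
  Nat.card (Quot (fun p q : {p : ℤ × ℤ × ℤ // superdisc p = n ∧ P p} =>
    quadEquiv p.1 q.1))

open Finset
open scoped NumberTheorySymbols

/-- The number of square roots of `d` modulo `a`. -/
def sqrtCount (a : ℕ) (d : ℤ) : ℕ := #{b ∈ range a | (a : ℤ) ∣ ((b : ℕ) : ℤ) ^ 2 - d}

theorem sum_range_mul {M : Type*} [AddCommMonoid M] (f : ℕ → M) (k a : ℕ) :
    ∑ b ∈ range (k * a), f b = ∑ b ∈ range a, ∑ z ∈ range k, f (b + a * z) := by
  induction k with
  | zero => simp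
  | succ k ih =>
    rw [add_mul, one_mul, sum_range_add, ih, ← sum_add_distrib]
    refine sum_congr rfl fun b _ => ?_
    rw [sum_range_succ, add_comm (k * a), mul_comm k]

theorem card_filter_range_mul (P : ℕ → Prop) [DecidablePred P] (k a : ℕ) :
    #{b ∈ range (k * a) | P b} = ∑ b ∈ range a, #{z ∈ range k | P (b + a * z)} := by
  simp only [card_filter, sum_range_mul]

theorem card_filter_range_mul_of_periodic (P : ℕ → Prop) [DecidablePred P] (k a : ℕ)
    (hP : ∀ b, P (b + a) ↔ P b) : #{b ∈ range (k * a) | P b} = k * #{b ∈ range a | P b} := by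
  have hz (b z : ℕ) : P (b + a * z) ↔ P b := by
    induction z with
    | zero => simp
    | succ z ih => rw [mul_add, mul_one, ← add_assoc, hP, ih]
  simp only [card_filter_range_mul, hz, card_filter _ (range a), mul_sum]
  refine sum_congr rfl fun b _ => ?_
  split_ifs with h <;> simp [h]

theorem sqrtCount_eq_natCard {a : ℕ} (ha : a ≠ 0) (d : ℤ) :
    sqrtCount a d = Nat.card {x : ZMod a // x ^ 2 = d} := by
  have : NeZero a := ⟨ha⟩
  rw [Nat.subtype_card {x : ZMod a | x ^ 2 = d} (by simp), sqrtCount]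
  have hiff (x : ℤ) : (x : ZMod a) ^ 2 = d ↔ (a : ℤ) ∣ x ^ 2 - d := by
    rw [← ZMod.intCast_zmod_eq_zero_iff_dvd, Int.cast_sub, sub_eq_zero, Int.cast_pow]
  refine card_nbij' (fun b => (b : ZMod a)) ZMod.val ?_ ?_ ?_ ?_
  · intro b hb
    simpa [← hiff] using (mem_filter.1 hb).2
  · intro x hx
    simpa [← hiff, ZMod.val_lt] using hx
  · intro b hb
    exact ZMod.val_cast_of_lt (mem_range.1 (mem_filter.1 hb).1)
  · intro x _
    exact ZMod.natCast_zmod_val x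

theorem sqrtCount_one (d : ℤ) : sqrtCount 1 d = 1 := by
  simp [sqrtCount]

theorem sqrtCount_mul {a b : ℕ} (ha : a ≠ 0) (hb : b ≠ 0) (hab : a.Coprime b) (d : ℤ) :
    sqrtCount (a * b) d = sqrtCount a d * sqrtCount b d := by
  rw [sqrtCount_eq_natCard ha, sqrtCount_eq_natCard hb, sqrtCount_eq_natCard (mul_ne_zero ha hb),
    ← Nat.card_prod]
  let e := ZMod.chineseRemainder hab
  refine Nat.card_congr ((e.toEquiv.subtypeEquiv
    (q := fun y => y.1 ^ 2 = (d : ZMod a) ∧ y.2 ^ 2 = (d : ZMod b)) fun x => ?_).trans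
    (Equiv.subtypeProdEquivProd (p := fun y : ZMod a => y ^ 2 = d)
      (q := fun y : ZMod b => y ^ 2 = d)))
  rw [← e.injective.eq_iff, map_pow, map_intCast, Prod.ext_iff]
  rfl

theorem sqrtCount_sq_mul {a : ℕ} (ha : a ≠ 0) {k : ℤ} (hk : IsCoprime k a) (d : ℤ) :
    sqrtCount a (k ^ 2 * d) = sqrtCount a d := by
  rw [sqrtCount_eq_natCard ha, sqrtCount_eq_natCard ha]
  obtain ⟨u, hu⟩ : IsUnit (k : ZMod a) := (ZMod.coe_int_isUnit_iff_isCoprime k a).2 hk.symm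
  refine (Nat.card_congr ((Units.mulLeft u).subtypeEquiv fun x => ?_)).symm
  simp only [Units.mulLeft_apply, Int.cast_mul, Int.cast_pow, ← hu, mul_pow,
    ← Units.val_pow_eq_pow_val, Units.mul_right_inj]

theorem sqrtCount_prime {p : ℕ} (hp : p.Prime) (hp2 : p ≠ 2) (d : ℤ) :
    (sqrtCount p d : ℤ) = 1 + jacobiSym d p := by
  have : Fact p.Prime := ⟨hp⟩
  rw [← jacobiSym.legendreSym.to_jacobiSym, add_comm, ← legendreSym.card_sqrts p hp2,
    sqrtCount_eq_natCard hp.ne_zero, ← Set.ncard_eq_toFinset_card']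
  rfl

theorem sqrtCount_prime_mul {p : ℕ} (hp : p.Prime) (d : ℤ) : sqrtCount p (p * d) = 1 := by
  rw [sqrtCount, card_eq_one]
  refine ⟨0, ?_⟩
  ext b
  have := hp.pos
  simp only [mem_filter, mem_range, mem_singleton, dvd_sub_left (dvd_mul_right (p : ℤ) d)]
  constructor
  · rintro ⟨h1, h2⟩
    have := (Nat.prime_iff_prime_int.1 hp).dvd_of_dvd_pow h2
    exact Nat.eq_zero_of_dvd_of_lt (by exact_mod_cast this) h1
  · rintro rfl
    simp [hp.pos]

theorem sqrtCount_pow_prime_mul {p : ℕ} (hp : p.Prime) (i : ℕ) {d : ℤ} (hd : ¬ (p : ℤ) ∣ d) :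
    sqrtCount (p ^ (i + 2)) (p * d) = 0 := by
  have hp' := Nat.prime_iff_prime_int.1 hp
  rw [sqrtCount, card_eq_zero, filter_eq_empty_iff]
  rintro b - h
  have h2 : (p : ℤ) ^ 2 ∣ (b : ℤ) ^ 2 - p * d :=
    (pow_dvd_pow _ (Nat.le_add_left 2 i)).trans (by exact_mod_cast h)
  have h1 : (p : ℤ) ∣ b := hp'.dvd_of_dvd_pow (n := 2) <|
    (dvd_sub_left (dvd_mul_right (p : ℤ) d)).1 ((dvd_pow_self _ two_ne_zero).trans h2)
  have h3 := (dvd_sub_right (pow_dvd_pow_of_dvd h1 2)).1 h2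
  rw [sq, mul_dvd_mul_iff_left hp'.ne_zero] at h3
  exact hd h3

theorem sqrtCount_pow_prime_sq_mul {p : ℕ} (hp : p.Prime) (i : ℕ) (d : ℤ) :
    sqrtCount (p ^ (i + 2)) (p ^ 2 * d) = p * sqrtCount (p ^ i) d := by
  have hp' := Nat.prime_iff_prime_int.1 hp
  have hp0 : (p : ℤ) ≠ 0 := hp'.ne_zero
  have key (b : ℕ) : ((p ^ i : ℕ) : ℤ) ∣ (b : ℤ) ^ 2 - d ↔
      ((p ^ (i + 2) : ℕ) : ℤ) ∣ ((p * b : ℕ) : ℤ) ^ 2 - p ^ 2 * d := by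
    push_cast
    rw [pow_add, mul_comm ((p : ℤ) ^ i), mul_pow, ← mul_sub,
      mul_dvd_mul_iff_left (pow_ne_zero 2 hp0)]
  rw [sqrtCount, sqrtCount, ← card_filter_range_mul_of_periodic]
  · symm
    refine card_bij (fun b _ => p * b) ?_ ?_ ?_
    · intro b hb
      rw [mem_filter, mem_range] at hb ⊢
      refine ⟨?_, (key b).1 hb.2⟩
      calc p * b < p * (p * p ^ i) := by gcongr; exacts [hp.pos, hb.1]
        _ = _ := by ring
    · intro b _ c _ h
      exact Nat.eq_of_mul_eq_mul_left hp.pos h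
    · intro b hb
      rw [mem_filter, mem_range] at hb
      have h1 : (p : ℤ) ∣ b := by
        refine hp'.dvd_of_dvd_pow (n := 2)
          ((dvd_sub_left (c := (p : ℤ) ^ 2 * d) ?_).1 (dvd_trans ?_ hb.2))
        · exact dvd_mul_of_dvd_left (dvd_pow_self _ two_ne_zero) _
        · exact_mod_cast dvd_pow_self p (by omega)
      obtain ⟨c, rfl⟩ : p ∣ b := by exact_mod_cast h1
      refine ⟨c, ?_, rfl⟩
      rw [mem_filter, mem_range, key]
      refine ⟨Nat.lt_of_mul_lt_mul_left (a := p) ?_, hb.2⟩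
      calc p * c < _ := hb.1
        _ = _ := by ring
  · intro b
    push_cast
    rw [show (b + p ^ i : ℤ) ^ 2 - d = (b ^ 2 - d) + p ^ i * (2 * b + p ^ i) by ring]
    exact dvd_add_left (dvd_mul_right _ _)

theorem sqrtCount_pow_prime {p : ℕ} (hp : p.Prime) (hp2 : p ≠ 2) (i : ℕ) {d : ℤ}
    (hd : ¬ (p : ℤ) ∣ d) : (sqrtCount (p ^ (i + 1)) d : ℤ) = 1 + jacobiSym d p := by
  have hp' := Nat.prime_iff_prime_int.1 hp
  have hp0 : (p : ℤ) ≠ 0 := hp'.ne_zero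
  induction i with
  | zero => simpa using sqrtCount_prime hp hp2 d
  | succ i ih =>
    rw [← ih, Nat.cast_inj, sqrtCount, sqrtCount, pow_succ' p (i + 1), card_filter_range_mul,
      card_filter _ (range (p ^ (i + 1)))]
    refine sum_congr rfl fun b _ => ?_
    push_cast
    split_ifs with h
    · obtain ⟨t, ht⟩ := h
      have hb : ¬ (p : ℤ) ∣ 2 * b := by
        intro h
        rcases hp'.dvd_or_dvd h with h | h
        · have : p ∣ 2 := by exact_mod_cast h
          exact hp2 ((Nat.prime_dvd_prime_iff_eq hp Nat.prime_two).1 this)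
        · apply hd
          have h1 : (p : ℤ) ∣ (b : ℤ) ^ 2 := dvd_pow h two_ne_zero
          refine (dvd_sub_right h1).1 ?_
          rw [ht, pow_succ', mul_assoc]
          exact dvd_mul_right _ _
      have hiff (z : ℕ) : (p : ℤ) * p ^ (i + 1) ∣ (b + p ^ (i + 1) * z : ℤ) ^ 2 - d ↔
          (p : ℤ) ∣ t + 2 * b * z := by
        rw [show (b + p ^ (i + 1) * z : ℤ) ^ 2 - d
          = (t + 2 * b * z + p * (p ^ i * z ^ 2)) * p ^ (i + 1) by
            linear_combination ht, mul_dvd_mul_iff_right (pow_ne_zero _ hp0)]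
        exact dvd_add_left (dvd_mul_right _ _)
      simp only [hiff]
      have : Fact p.Prime := ⟨hp⟩
      have hb' : ((2 * b : ℤ) : ZMod p) ≠ 0 := by rwa [Ne, ZMod.intCast_zmod_eq_zero_iff_dvd]
      rw [card_eq_one]
      refine ⟨(-(t : ZMod p) / ((2 * b : ℤ) : ZMod p)).val, ?_⟩
      ext z
      rw [mem_filter, mem_range, mem_singleton, ← ZMod.intCast_zmod_eq_zero_iff_dvd]
      constructor
      · rintro ⟨h1, h2⟩
        rw [← ZMod.val_cast_of_lt h1]
        congr 1
        rw [eq_div_iff hb']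
        push_cast at h2 ⊢
        linear_combination h2
      · rintro rfl
        refine ⟨ZMod.val_lt _, ?_⟩
        push_cast at hb' ⊢
        rw [ZMod.natCast_zmod_val]
        rw [mul_div_cancel₀ _ hb', add_neg_cancel]
    · rw [card_eq_zero, filter_eq_empty_iff]
      intro z _ hz
      apply h
      have h1 := (Dvd.intro_left _ rfl).trans hz
      rw [show (b + p ^ (i + 1) * z : ℤ) ^ 2 - d
        = (b ^ 2 - d) + p ^ (i + 1) * (2 * b * z + p ^ (i + 1) * z ^ 2) by ring] at h1
      exact (dvd_add_left (dvd_mul_right _ _)).1 h1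

theorem card_half_sqrt_two_pow (i : ℕ) {d : ℤ} (hd : Odd d) :
    #{b ∈ range (2 ^ (i + 2)) | (2 : ℤ) ^ (i + 3) ∣ ((b : ℕ) : ℤ) ^ 2 - d}
      = if d % 8 = 1 then 2 else 0 := by
  induction i with
  | zero =>
    have h (b : ℤ) : (8 : ℤ) ∣ b ^ 2 - d ↔ d % 8 = b ^ 2 % 8 := Int.modEq_iff_dvd.symm
    have h8 : d % 8 = 1 ∨ d % 8 = 3 ∨ d % 8 = 5 ∨ d % 8 = 7 := by
      have := Int.odd_iff.1 hd
      omega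
    norm_num [h]
    rcases h8 with h8 | h8 | h8 | h8 <;> rw [h8] <;> decide
  | succ i ih =>
    rw [← ih, show 2 ^ (i + 1 + 2) = 2 * 2 ^ (i + 2) by ring, card_filter_range_mul,
      card_filter _ (range (2 ^ (i + 2)))]
    refine sum_congr rfl fun b _ => ?_
    have h0 : (2 : ℤ) ^ (i + 3) ≠ 0 := by positivity
    have hpow : (2 : ℤ) ^ (i + 1 + 3) = 2 ^ (i + 3) * 2 := by ring
    push_cast
    split_ifs with h
    · obtain ⟨t, ht⟩ := h
      have hb : Odd (b : ℤ) := by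
        have h2 : (b : ℤ) ^ 2 = d + 2 * (2 ^ (i + 2) * t) := by linear_combination ht
        have h3 : Odd ((b : ℤ) ^ 2) := h2 ▸ hd.add_even (even_two_mul _)
        exact Int.odd_pow' two_ne_zero |>.1 h3
      obtain ⟨c, hc⟩ := hb
      have hiff (z : ℕ) : (2 : ℤ) ^ (i + 1 + 3) ∣ (b + 2 ^ (i + 2) * z : ℤ) ^ 2 - d ↔
          (2 : ℤ) ∣ t + z := by
        rw [show (b + 2 ^ (i + 2) * z : ℤ) ^ 2 - d
          = 2 ^ (i + 3) * (t + z + 2 * (c * z + 2 ^ i * z ^ 2)) by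
            rw [hc] at ht ⊢
            linear_combination ht, hpow, mul_dvd_mul_iff_left h0]
        exact dvd_add_left (dvd_mul_right _ _)
      simp only [hiff]
      rcases Int.even_or_odd' t with ⟨u, rfl | rfl⟩
      · rw [card_eq_one]
        refine ⟨0, ?_⟩
        ext z
        simp only [mem_filter, mem_range, mem_singleton]
        omega
      · rw [card_eq_one]
        refine ⟨1, ?_⟩
        ext z
        simp only [mem_filter, mem_range, mem_singleton]
        omega
    · rw [card_eq_zero, filter_eq_empty_iff]
      intro z _ hz
      apply h
      have h1 := (Dvd.intro _ hpow.symm).trans hz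
      rw [show (b + 2 ^ (i + 2) * z : ℤ) ^ 2 - d
        = (b ^ 2 - d) + 2 ^ (i + 3) * (b * z + 2 ^ (i + 1) * z ^ 2) by ring] at h1
      exact (dvd_add_left (dvd_mul_right _ _)).1 h1

/-- The number of `b` modulo `2a` with `b² ≡ d` modulo `4a` is half of the number of square roots
of `d` modulo `4a`. -/
theorem sqrtCount_four_mul (a : ℕ) (d : ℤ) :
    sqrtCount (4 * a) d
      = 2 * #{b ∈ range (2 * a) | (4 * a : ℤ) ∣ ((b : ℕ) : ℤ) ^ 2 - d} := by
  rw [sqrtCount, ← card_filter_range_mul_of_periodic, ← mul_assoc]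
  · push_cast
    rfl
  · intro b
    push_cast
    rw [show (b + 2 * a : ℤ) ^ 2 - d = (b ^ 2 - d) + 4 * a * (b + a) by ring]
    exact dvd_add_left (dvd_mul_right _ _)

theorem sqrtCount_two_pow (i : ℕ) {d : ℤ} (hd : Odd d) :
    sqrtCount (2 ^ (i + 3)) d = if d % 8 = 1 then 4 else 0 := by
  have h := card_half_sqrt_two_pow i hd
  have h4 := sqrtCount_four_mul (2 ^ (i + 1)) d
  rw [show 4 * 2 ^ (i + 1) = 2 ^ (i + 3) by ring, show 2 * 2 ^ (i + 1) = 2 ^ (i + 2) by ring] at h4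
  push_cast at h4
  rw [h4, show (4 : ℤ) * 2 ^ (i + 1) = 2 ^ (i + 3) by ring, h]
  split_ifs <;> rfl

theorem sqrtCount_two (d : ℤ) : sqrtCount 2 d = 1 := by
  have h (b : ℤ) : (2 : ℤ) ∣ b ^ 2 - d ↔ d % 2 = b ^ 2 % 2 := Int.modEq_iff_dvd.symm
  simp only [sqrtCount, Nat.cast_ofNat, h]
  rcases Int.emod_two_eq_zero_or_one d with h | h <;> rw [h] <;> decide

theorem sqrtCount_four {d : ℤ} (hd : Odd d) : sqrtCount 4 d = if d % 4 = 1 then 2 else 0 := by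
  have h (b : ℤ) : (4 : ℤ) ∣ b ^ 2 - d ↔ d % 4 = b ^ 2 % 4 := Int.modEq_iff_dvd.symm
  simp only [sqrtCount, Nat.cast_ofNat, h]
  have h4 : d % 4 = 1 ∨ d % 4 = 3 := by
    have := Int.odd_iff.1 hd
    omega
  rcases h4 with h | h <;> rw [h] <;> decide

theorem Nat.Coprime.sum_divisorsAntidiagonal_mul {M : Type*} [AddCommMonoid M] {a b : ℕ}
    (hab : a.Coprime b) (f : ℕ → ℕ → M) :
    ∑ q ∈ (a * b).divisorsAntidiagonal, f q.1 q.2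
      = ∑ q ∈ a.divisorsAntidiagonal, ∑ r ∈ b.divisorsAntidiagonal, f (q.1 * r.1) (q.2 * r.2) := by
  rw [← sum_product']
  symm
  refine sum_bij (fun x _ => (x.1.1 * x.2.1, x.1.2 * x.2.2)) ?_ ?_ ?_ ?_
  · rintro ⟨⟨u, v⟩, ⟨s, t⟩⟩ h
    simp only [mem_product, Nat.mem_divisorsAntidiagonal] at h ⊢
    obtain ⟨⟨rfl, h1⟩, rfl, h2⟩ := h
    exact ⟨by ring, mul_ne_zero h1 h2⟩
  · rintro ⟨⟨u, v⟩, ⟨s, t⟩⟩ h ⟨⟨u', v'⟩, ⟨s', t'⟩⟩ h' he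
    simp only [mem_product, Nat.mem_divisorsAntidiagonal, Prod.mk.injEq] at h h' he ⊢
    have ha : a ≠ 0 := h.1.2
    have hb : b ≠ 0 := h.2.2
    have key {x x' y y' : ℕ} (hx : x ∣ a) (hx' : x' ∣ a) (hy : y ∣ b) (hy' : y' ∣ b)
        (h : x * y = x' * y') : x = x' ∧ y = y' := by
      simpa using hab.mul_injOn_divisors (x₁ := (x, y)) (x₂ := (x', y')) (by simp [*])
        (by simp [*]) h
    obtain ⟨h1, h2⟩ := key (Dvd.intro _ h.1.1) (Dvd.intro _ h'.1.1) (Dvd.intro _ h.2.1)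
      (Dvd.intro _ h'.2.1) he.1
    obtain ⟨h3, h4⟩ := key (Dvd.intro_left _ h.1.1) (Dvd.intro_left _ h'.1.1)
      (Dvd.intro_left _ h.2.1) (Dvd.intro_left _ h'.2.1) he.2
    exact ⟨⟨h1, h3⟩, h2, h4⟩
  · rintro ⟨x, y⟩ h
    simp only [Nat.mem_divisorsAntidiagonal] at h
    obtain ⟨h, h0⟩ := h
    obtain ⟨u, s, ⟨v, rfl⟩, ⟨t, rfl⟩, rfl⟩ := exists_dvd_and_dvd_of_dvd_mul (Dvd.intro y h)
    have hus : u * s ≠ 0 := fun h' => h0 (by rw [← h, h', zero_mul])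
    refine ⟨((u, v), (s, t)), ?_, ?_⟩
    · simp only [mem_product, Nat.mem_divisorsAntidiagonal, true_and]
      exact ⟨left_ne_zero_of_mul h0, right_ne_zero_of_mul h0⟩
    · rw [Prod.mk.injEq]
      refine ⟨rfl, Nat.eq_of_mul_eq_mul_left (Nat.pos_of_ne_zero hus) ?_⟩
      rw [h]
      ring
  · intros
    rfl

theorem Nat.Prime.sum_divisorsAntidiagonal_pow {M : Type*} [AddCommMonoid M] {p : ℕ}
    (hp : p.Prime) (m : ℕ) (f : ℕ → ℕ → M) :
    ∑ q ∈ (p ^ m).divisorsAntidiagonal, f q.1 q.2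
      = ∑ x ∈ antidiagonal m, f (p ^ x.1) (p ^ x.2) := by
  rw [Nat.sum_divisorsAntidiagonal (fun i j => f i j), Nat.divisors_prime_pow hp, sum_map,
    Nat.sum_antidiagonal_eq_sum_range_succ (fun i j => f (p ^ i) (p ^ j))]
  refine sum_congr rfl fun i hi => ?_
  rw [mem_range] at hi
  simp only [Function.Embedding.coeFn_mk, Nat.pow_div (Nat.lt_succ_iff.1 hi) hp.pos]

theorem sum_antidiagonal_add_four {M : Type*} [AddCommMonoid M] (m : ℕ) (f : ℕ → ℕ → M) :
    ∑ x ∈ antidiagonal (m + 4), f x.1 x.2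
      = f 0 (m + 4) + f 1 (m + 3) + f (m + 3) 1 + f (m + 4) 0
        + ∑ x ∈ antidiagonal m, f (x.1 + 2) (x.2 + 2) := by
  simp only [Finset.Nat.sum_antidiagonal_succ, Finset.Nat.sum_antidiagonal_succ' (n := m + 1),
    Finset.Nat.sum_antidiagonal_succ' (n := m), add_assoc, Nat.reduceAdd, zero_add]
  congr 2
  rw [add_left_comm]

/-- Square roots of `w * d` modulo `a`, summed over the factorizations `a * d = N` against a weight
that only sees `d` modulo squares, can be expanded into Jacobi symbols `J(w * δ | e)` with
coefficients symmetric in `e` and `δ`. -/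
def HasSymmExpansion (N : ℕ) : Prop :=
  ∃ (ι : Type) (_ : Fintype ι) (σ : Equiv.Perm ι) (c : ι → ℤ) (e δ : ι → ℕ),
    (∀ i, c (σ i) = c i ∧ e (σ i) = δ i ∧ δ (σ i) = e i) ∧ (∀ i, e i ∣ N ∧ δ i ∣ N) ∧
    ∀ (w : ℤ) (φ : ℕ → ℤ), IsCoprime w N → (∀ k, k ∣ N → ∀ d, φ (k ^ 2 * d) = φ d) →
      ∑ q ∈ N.divisorsAntidiagonal, sqrtCount q.1 (w * q.2) * φ q.2
        = ∑ i, c i * J(w * δ i | e i) * φ (δ i)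

theorem hasSymmExpansion_one : HasSymmExpansion 1 := by
  refine ⟨Unit, inferInstance, Equiv.refl _, fun _ => 1, fun _ => 1, fun _ => 1, ?_, ?_, ?_⟩ <;>
    simp [sqrtCount_one]

theorem exists_sum_sqrtCount_prime_pow {p : ℕ} (hp : p.Prime) (hp2 : p ≠ 2) (m : ℕ) :
    ∃ α β : ℤ, ∀ (w : ℤ) (φ : ℕ → ℤ), ¬ (p : ℤ) ∣ w → (∀ d, φ (p ^ 2 * d) = φ d) →
      ∑ x ∈ antidiagonal m, sqrtCount (p ^ x.1) (w * (p ^ x.2 : ℕ)) * φ (p ^ x.2)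
        = α * φ 1 + β * (J(w | p) * φ 1 + φ p) := by
  have hmul (w : ℤ) (j : ℕ) : w * (p : ℤ) ^ (j + 1) = p * (w * p ^ j) := by ring
  have hφ1 {φ : ℕ → ℤ} (h : ∀ d, φ (p ^ 2 * d) = φ d) (j : ℕ) :
      φ (p ^ (j + 2)) = φ (p ^ j) := by rw [add_comm, pow_add, h]
  have hφ2 {φ : ℕ → ℤ} (h : ∀ d, φ (p ^ 2 * d) = φ d) (j : ℕ) :
      φ (p ^ (j + 1)) + φ (p ^ j) = φ 1 + φ p := by
    induction j with
    | zero => rw [zero_add, pow_one, pow_zero, add_comm]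
    | succ j ih => rw [hφ1 h, add_comm, ih]
  induction m using Nat.strong_induction_on with
  | _ m ih =>
    rcases m with _ | _ | _ | _ | m
    · exact ⟨1, 0, fun w φ _ _ => by simp [sqrtCount_one]⟩
    · refine ⟨1, 1, fun w φ _ _ => ?_⟩
      simp [Nat.sum_antidiagonal_succ, sqrtCount_one, sqrtCount_prime hp hp2]
      ring
    · refine ⟨2, 1, fun w φ hw hφ => ?_⟩
      have h1 := hφ1 hφ 0
      have h2 := sqrtCount_prime_mul hp w
      have h3 := sqrtCount_pow_prime hp hp2 1 hw
      rw [mul_comm] at h2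
      simp [Nat.sum_antidiagonal_succ, sqrtCount_one] at h1 h3 ⊢
      simp [h1, h2, h3]
      ring
    · refine ⟨2, 1, fun w φ hw hφ => ?_⟩
      have h1 := hφ1 hφ 0
      have h1' := hφ1 hφ 1
      have h2 := sqrtCount_prime_mul hp (w * p)
      have h3 := sqrtCount_pow_prime hp hp2 2 hw
      have h4 := sqrtCount_pow_prime_mul hp 0 hw
      rw [show (p : ℤ) * (w * p) = w * p ^ 2 by ring] at h2
      rw [mul_comm] at h4
      simp [Nat.sum_antidiagonal_succ, sqrtCount_one] at h1 h1' h3 h4 ⊢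
      simp [h1, h1', h2, h3, h4]
      ring
    · obtain ⟨α, β, h⟩ := ih m (by omega)
      refine ⟨2 + p * α, 1 + p * β, fun w φ hw hφ => ?_⟩
      have h1 : sqrtCount p (w * (p ^ (m + 3) : ℕ)) = 1 := by
        push_cast
        rw [hmul, sqrtCount_prime_mul hp]
      have h2 : sqrtCount (p ^ (m + 3)) (w * p) = 0 := by
        rw [mul_comm, sqrtCount_pow_prime_mul hp (m + 1) hw]
      have h3 := sqrtCount_pow_prime hp hp2 (m + 3) hw
      have h4 (i j : ℕ) : (sqrtCount (p ^ (i + 2)) (w * (p ^ (j + 2) : ℕ)) : ℤ) * φ (p ^ (j + 2))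
          = p * (sqrtCount (p ^ i) (w * (p ^ j : ℕ)) * φ (p ^ j)) := by
        push_cast
        rw [show w * (p : ℤ) ^ (j + 2) = p ^ 2 * (w * p ^ j) by ring,
          sqrtCount_pow_prime_sq_mul hp, hφ1 hφ]
        push_cast
        ring
      have h5 := hφ2 hφ (m + 3)
      rw [sum_antidiagonal_add_four m fun i j =>
        (sqrtCount (p ^ i) (w * (p ^ j : ℕ)) : ℤ) * φ (p ^ j)]
      simp only [h4, ← mul_sum, h w φ hw hφ, pow_zero, pow_one, sqrtCount_one, h1, h2,
        Nat.cast_one, mul_one, h3]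
      push_cast
      linear_combination h5

theorem hasSymmExpansion_prime_pow {p : ℕ} (hp : p.Prime) (hp2 : p ≠ 2) {m : ℕ} (hm : 0 < m) :
    HasSymmExpansion (p ^ m) := by
  obtain ⟨α, β, h⟩ := exists_sum_sqrtCount_prime_pow hp hp2 m
  have hpm : p ∣ p ^ m := dvd_pow_self p hm.ne'
  refine ⟨Fin 3, inferInstance, Equiv.swap 1 2, ![α, β, β], ![1, p, 1], ![1, 1, p], ?_, ?_, ?_⟩
  · intro i
    fin_cases i <;> simp [Equiv.swap_apply_def]
  · intro i
    fin_cases i <;> simp [hpm]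
  · intro w φ hw hφ
    rw [hp.sum_divisorsAntidiagonal_pow m fun a d => (sqrtCount a (w * d) : ℤ) * φ d,
      h w φ ?_ (hφ p hpm)]
    · simp [Fin.sum_univ_three]
      ring
    · intro hpw
      have := hw.of_isCoprime_of_dvd_left hpw |>.of_isCoprime_of_dvd_right
        (Int.natCast_dvd_natCast.2 hpm)
      exact (Nat.prime_iff_prime_int.1 hp).not_isUnit (isCoprime_self.1 this)

theorem jacobiSym_sq_mul {k : ℤ} {b : ℕ} (hk : IsCoprime k b) (a : ℤ) :
    J(k ^ 2 * a | b) = J(a | b) := by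
  rw [jacobiSym.mul_left, jacobiSym.sq_one' (Int.isCoprime_iff_gcd_eq_one.1 hk), one_mul]

theorem HasSymmExpansion.mul {M N : ℕ} (hMN : M.Coprime N) (hM0 : M ≠ 0) (hN0 : N ≠ 0)
    (hM : HasSymmExpansion M) (hN : HasSymmExpansion N) : HasSymmExpansion (M * N) := by
  obtain ⟨ι, _, σ, c, e, δ, hσ, hdvd, hsum⟩ := hM
  obtain ⟨ι', _, σ', c', e', δ', hσ', hdvd', hsum'⟩ := hN
  have cop {x y : ℕ} (hx : x ∣ M) (hy : y ∣ N) : IsCoprime (x : ℤ) (y : ℤ) :=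
    Nat.isCoprime_iff_coprime.2 (hMN.of_dvd hx hy)
  refine ⟨ι × ι', inferInstance, σ.prodCongr σ', fun i => c i.1 * c' i.2,
    fun i => e i.1 * e' i.2, fun i => δ i.1 * δ' i.2, ?_, ?_, ?_⟩
  · intro i
    simp [hσ, hσ']
  · intro i
    exact ⟨mul_dvd_mul (hdvd i.1).1 (hdvd' i.2).1, mul_dvd_mul (hdvd i.1).2 (hdvd' i.2).2⟩
  · intro w φ hw hφ
    have hwM : IsCoprime w M := hw.of_isCoprime_of_dvd_right ⟨N, by push_cast; rfl⟩
    have hwN : IsCoprime w N := hw.of_isCoprime_of_dvd_right ⟨M, by push_cast; ring⟩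
    have ne0 {x y : ℕ} (hx : x ∣ y) (hy : y ≠ 0) : x ≠ 0 := ne_zero_of_dvd_ne_zero hy hx
    calc ∑ q ∈ (M * N).divisorsAntidiagonal, (sqrtCount q.1 (w * q.2) : ℤ) * φ q.2
        = ∑ r ∈ N.divisorsAntidiagonal, ∑ q ∈ M.divisorsAntidiagonal,
            (sqrtCount q.1 (w * r.2 * q.2) : ℤ)
              * (sqrtCount r.1 (w * r.2 * q.2) * φ (q.2 * r.2)) := by
          rw [hMN.sum_divisorsAntidiagonal_mul fun a d => (sqrtCount a (w * d) : ℤ) * φ d, sum_comm]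
          refine sum_congr rfl fun r hr => sum_congr rfl fun q hq => ?_
          rw [Nat.mem_divisorsAntidiagonal] at hr hq
          have hq1 : q.1 ∣ M := Dvd.intro _ hq.1
          have hr1 : r.1 ∣ N := Dvd.intro _ hr.1
          rw [sqrtCount_mul (ne0 hq1 hM0) (ne0 hr1 hN0) (hMN.of_dvd hq1 hr1),
            show w * ((q.2 * r.2 : ℕ) : ℤ) = w * r.2 * q.2 by push_cast; ring]
          push_cast
          ring
      _ = ∑ r ∈ N.divisorsAntidiagonal, ∑ i, c i * J(w * r.2 * δ i | e i)
              * (sqrtCount r.1 (w * r.2 * δ i) * φ (δ i * r.2)) := by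
          refine sum_congr rfl fun r hr => ?_
          rw [Nat.mem_divisorsAntidiagonal] at hr
          have hr1 : r.1 ∣ N := Dvd.intro _ hr.1
          have hr2 : r.2 ∣ N := Dvd.intro_left _ hr.1
          refine hsum (w * r.2) (fun d => sqrtCount r.1 (w * r.2 * d) * φ (d * r.2))
            (hwM.mul_left (cop dvd_rfl hr2).symm) fun k hk d => ?_
          rw [mul_assoc (k ^ 2), hφ k (hk.mul_right N)]
          push_cast
          rw [mul_left_comm, sqrtCount_sq_mul (ne0 hr1 hN0) (cop hk hr1)]
      _ = ∑ i, c i * ∑ r ∈ N.divisorsAntidiagonal, (sqrtCount r.1 (w * δ i * r.2) : ℤ)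
              * (J(w * δ i * r.2 | e i) * φ (δ i * r.2)) := by
          rw [sum_comm]
          refine sum_congr rfl fun i _ => ?_
          rw [mul_sum]
          refine sum_congr rfl fun r _ => ?_
          rw [mul_right_comm w]
          ring
      _ = ∑ i, c i * ∑ j, c' j * J(w * δ i * δ' j | e' j)
              * (J(w * δ i * δ' j | e i) * φ (δ i * δ' j)) := by
          refine sum_congr rfl fun i _ => congrArg _ ?_
          refine hsum' (w * δ i) (fun d => J(w * δ i * d | e i) * φ (δ i * d))
            (hwN.mul_left (cop (hdvd i).2 dvd_rfl)) fun k hk d => ?_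
          rw [mul_left_comm (δ i), hφ k (hk.mul_left M)]
          push_cast
          rw [mul_left_comm, jacobiSym_sq_mul (cop (hdvd i).1 hk).symm]
      _ = _ := by
          rw [Fintype.sum_prod_type]
          refine sum_congr rfl fun i _ => ?_
          rw [mul_sum]
          refine sum_congr rfl fun j _ => ?_
          rw [jacobiSym.mul_right' _ (ne0 (hdvd i).1 hM0) (ne0 (hdvd' j).1 hN0)]
          push_cast
          rw [← mul_assoc w]
          ring

theorem hasSymmExpansion_of_odd {N : ℕ} (hN : Odd N) : HasSymmExpansion N := by
  induction N using Nat.recOnPosPrimePosCoprime with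
  | prime_pow p m hp hm =>
    refine hasSymmExpansion_prime_pow hp ?_ hm
    rintro rfl
    exact (Nat.not_odd_iff_even.2 ((even_two).pow_of_ne_zero hm.ne')) hN
  | zero => simp at hN
  | one => exact hasSymmExpansion_one
  | coprime a b ha hb hab iha ihb =>
    rw [Nat.odd_mul] at hN
    exact (iha hN.1).mul hab (by omega) (by omega) (ihb hN.2)

theorem sqrtCount_four_two_pow_mul (j : ℕ) (d : ℤ) : sqrtCount 4 (2 ^ (j + 2) * d) = 2 := by
  rw [show (2 : ℤ) ^ (j + 2) * d = (2 : ℕ) ^ 2 * (2 ^ j * d) by push_cast; ring,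
    show 4 = 2 ^ (0 + 2) from rfl, sqrtCount_pow_prime_sq_mul Nat.prime_two, pow_zero,
    sqrtCount_one]

theorem sqrtCount_eight_two_pow_mul (j : ℕ) (d : ℤ) : sqrtCount 8 (2 ^ (j + 2) * d) = 2 := by
  rw [show (2 : ℤ) ^ (j + 2) * d = (2 : ℕ) ^ 2 * (2 ^ j * d) by push_cast; ring,
    show 8 = 2 ^ (1 + 2) from rfl, sqrtCount_pow_prime_sq_mul Nat.prime_two, pow_one,
    sqrtCount_two]

theorem sqrtCount_two_pow_two_mul (i : ℕ) {d : ℤ} (hd : Odd d) :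
    sqrtCount (2 ^ (i + 2)) (2 * d) = 0 :=
  sqrtCount_pow_prime_mul Nat.prime_two i (by
    rw [Nat.cast_ofNat, ← even_iff_two_dvd, Int.not_even_iff_odd]
    exact hd)

/-- The part of `sum_sqrtCount_reflection` at the prime `2`: adding the two signs exchanges the roles
of `e` and `δ`. -/
theorem sum_sqrtCount_two_pow_reflection {e δ : ℕ} (he : Odd e) (hδ : Odd δ) (s : ℕ) :
    ∑ x ∈ antidiagonal s, (J(2 ^ x.2 * δ | e) * sqrtCount (2 ^ x.1) (2 ^ x.2 * δ)
        + J(-2 ^ x.2 * δ | e) * sqrtCount (2 ^ x.1) (-2 ^ x.2 * δ))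
      = ∑ x ∈ antidiagonal s, J(2 ^ x.2 * e | δ) * sqrtCount (2 ^ (x.1 + 2)) (2 ^ x.2 * e) := by
  have hδ' : Odd (δ : ℤ) := by exact_mod_cast hδ
  have he' : Odd (e : ℤ) := by exact_mod_cast he
  have hJ (y : ℕ) : J(2 ^ y * δ | e) = J(2 | e) ^ y * J(δ | e) := by
    rw [jacobiSym.mul_left, jacobiSym.pow_left]
  have hJn (y : ℕ) : J(-2 ^ y * δ | e) = J(-1 | e) * J(2 | e) ^ y * J(δ | e) := by
    rw [neg_eq_neg_one_mul, mul_assoc, jacobiSym.mul_left, hJ, mul_assoc]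
  have hJ' (y : ℕ) : J(2 ^ y * e | δ) = J(2 | δ) ^ y * J(e | δ) := by
    rw [jacobiSym.mul_left, jacobiSym.pow_left]
  have hsq {b : ℕ} (hb : Odd b) : J(2 | b) ^ 2 = 1 := jacobiSym.sq_one (by
    exact_mod_cast Nat.coprime_two_left.2 hb)
  have hpar {b : ℕ} (hb : Odd b) (y : ℕ) : J(2 | b) ^ (y + 1) + J(2 | b) ^ y = 1 + J(2 | b) := by
    induction y with
    | zero => ring
    | succ y ih => linear_combination ih + J(2 | b) ^ y * hsq hb
  have hδ2 := Nat.odd_iff.1 hδ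
  have he2' := Nat.odd_iff.1 he
  have he2 := jacobiSym.at_two he
  have heneg := jacobiSym.at_neg_one he
  have hrec := jacobiSym.quadratic_reciprocity_if (Nat.odd_iff.1 hδ) (Nat.odd_iff.1 he)
  rw [ZMod.χ₈_nat_eq_if_mod_eight] at he2
  rw [ZMod.χ₄_nat_eq_if_mod_four] at heneg
  have hfour : J(δ | e) * (1 + J(-1 | e)) = J(e | δ) * sqrtCount 4 e := by
    rw [sqrtCount_four he', heneg, ← hrec]
    split_ifs <;> first | (exfalso; omega) | (push_cast; ring)
  have hhalf (i : ℕ) : J(δ | e) * ((1 + J(2 | e)) * (1 + J(-1 | e)))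
      = J(e | δ) * sqrtCount (2 ^ (i + 3)) e := by
    rw [sqrtCount_two_pow i he', he2, heneg, ← hrec]
    split_ifs <;> first | (exfalso; omega) | (push_cast; ring)
  have hunit : J(δ | e) * (sqrtCount 4 δ + J(-1 | e) * sqrtCount 4 (-δ)) = J(e | δ) * 2 := by
    rw [sqrtCount_four hδ', sqrtCount_four hδ'.neg, heneg, ← hrec]
    split_ifs <;> first | (exfalso; omega) | (push_cast; ring)
  have hunit' (i : ℕ) : J(δ | e) * (sqrtCount (2 ^ (i + 3)) δ
      + J(-1 | e) * sqrtCount (2 ^ (i + 3)) (-δ)) = J(e | δ) * (2 + 2 * J(2 | δ)) := by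
    rw [sqrtCount_two_pow i hδ', sqrtCount_two_pow i hδ'.neg, heneg, jacobiSym.at_two hδ,
      ZMod.χ₈_nat_eq_if_mod_eight, ← hrec]
    split_ifs <;> first | (exfalso; omega) | (push_cast; ring)
  have hstep (i j : ℕ) (d : ℤ) : (sqrtCount (2 ^ (i + 2)) (2 ^ (j + 2) * d) : ℤ)
      = 2 * sqrtCount (2 ^ i) (2 ^ j * d) := by
    rw [show (2 : ℤ) ^ (j + 2) * d = (2 : ℕ) ^ 2 * (2 ^ j * d) by push_cast; ring,
      sqrtCount_pow_prime_sq_mul Nat.prime_two]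
    push_cast
    rfl
  have hneg (a y : ℕ) (d : ℤ) : sqrtCount a (-2 ^ y * d) = sqrtCount a (2 ^ y * -d) := by
    rw [neg_mul_comm]
  simp only [hJ, hJn, hJ', hneg]
  induction s using Nat.strong_induction_on with
  | _ s ih =>
    rcases s with _ | _ | _ | _ | s
    · simp [sqrtCount_one]
      linear_combination hfour
    · have h1 := sqrtCount_two_pow_two_mul 0 he'
      have h2 := hhalf 0
      simp [Nat.sum_antidiagonal_succ, sqrtCount_one, sqrtCount_two] at h1 h2 ⊢
      simp [h1]
      linear_combination h2
    · have h1 := sqrtCount_two_pow_two_mul 1 he'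
      have h2 := hhalf 1
      have h3 := sqrtCount_four_two_pow_mul 0 e
      simp [Nat.sum_antidiagonal_succ, sqrtCount_one, sqrtCount_two, hsq he, hsq hδ]
        at h1 h2 h3 ⊢
      simp [h1, h3]
      linear_combination h2 + hunit
    · have h1 := sqrtCount_two_pow_two_mul 2 he'
      have h1' := sqrtCount_two_pow_two_mul 0 hδ'
      have h1'' := sqrtCount_two_pow_two_mul 0 hδ'.neg
      have h2 := hhalf 2
      have h3 := sqrtCount_four_two_pow_mul 1 e
      have h4 := sqrtCount_eight_two_pow_mul 0 e
      have h5 := hunit' 0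
      simp [Nat.sum_antidiagonal_succ, sqrtCount_one, sqrtCount_two, hsq he, hsq hδ]
        at h1 h1' h1'' h2 h3 h4 h5 ⊢
      simp [h1, h1', h1'', h3, h4]
      linear_combination h2 + h5 + J(δ | e) * (1 + J(-1 | e)) * J(2 | e) * hsq he
        - 2 * J(e | δ) * J(2 | δ) * hsq hδ
    · rw [sum_antidiagonal_add_four s fun i j => J(2 | e) ^ j * J(δ | e)
          * (sqrtCount (2 ^ i) (2 ^ j * δ) : ℤ) + J(-1 | e) * J(2 | e) ^ j * J(δ | e)
          * (sqrtCount (2 ^ i) (2 ^ j * -δ) : ℤ),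
        sum_antidiagonal_add_four s fun i j => J(2 | δ) ^ j * J(e | δ)
          * (sqrtCount (2 ^ (i + 2)) (2 ^ j * e) : ℤ)]
      have ih := ih s (by omega)
      have h1 := sqrtCount_two_pow_two_mul (s + 3) he'
      have h1' := sqrtCount_two_pow_two_mul (s + 1) hδ'
      have h1'' := sqrtCount_two_pow_two_mul (s + 1) hδ'.neg
      have h2 := hhalf (s + 3)
      have h3 := sqrtCount_four_two_pow_mul (s + 2) e
      have h4 := sqrtCount_eight_two_pow_mul (s + 1) e
      have h5 := hunit' (s + 1)
      have hstepL (x : ℕ × ℕ) : J(2 | e) ^ (x.2 + 2) * J(δ | e)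
            * (sqrtCount (2 ^ (x.1 + 2)) (2 ^ (x.2 + 2) * δ) : ℤ)
          + J(-1 | e) * J(2 | e) ^ (x.2 + 2) * J(δ | e)
            * (sqrtCount (2 ^ (x.1 + 2)) (2 ^ (x.2 + 2) * -δ) : ℤ)
          = 2 * (J(2 | e) ^ x.2 * J(δ | e) * (sqrtCount (2 ^ x.1) (2 ^ x.2 * δ) : ℤ)
          + J(-1 | e) * J(2 | e) ^ x.2 * J(δ | e) * (sqrtCount (2 ^ x.1) (2 ^ x.2 * -δ) : ℤ)) := by
        rw [hstep, hstep, pow_add, hsq he]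
        ring
      have hstepR (x : ℕ × ℕ) : J(2 | δ) ^ (x.2 + 2) * J(e | δ)
            * (sqrtCount (2 ^ (x.1 + 2 + 2)) (2 ^ (x.2 + 2) * e) : ℤ)
          = 2 * (J(2 | δ) ^ x.2 * J(e | δ) * (sqrtCount (2 ^ (x.1 + 2)) (2 ^ x.2 * e) : ℤ)) := by
        rw [hstep, pow_add, hsq hδ]
        ring
      simp only [hstepL, hstepR, ← mul_sum, ih]
      simp only [Nat.reduceAdd, Nat.reducePow, add_assoc, pow_zero, pow_one, one_mul,
        sqrtCount_one, sqrtCount_two, zero_add] at h1 h1' h1'' h2 h3 h4 h5 ⊢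
      simp only [h1, h1', h1'', h3, h4]
      push_cast
      linear_combination h2 + h5 + J(δ | e) * (1 + J(-1 | e)) * hpar he (s + 3)
        - 2 * J(e | δ) * hpar hδ (s + 3)

/-- Summed over the factorizations `m = a * d`, the square roots of `d` and of `-d` modulo `a` are as
many as the square roots of `d` modulo `4a`. -/
theorem sum_sqrtCount_reflection {m : ℕ} (hm : m ≠ 0) :
    ∑ q ∈ m.divisorsAntidiagonal, (sqrtCount q.1 q.2 + sqrtCount q.1 (-q.2))
      = ∑ q ∈ m.divisorsAntidiagonal, sqrtCount (4 * q.1) q.2 := by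
  obtain ⟨s, N, hN, rfl⟩ := Nat.exists_eq_two_pow_mul_odd hm
  obtain ⟨ι, _, σ, c, e, δ, hσ, hdvd, hsum⟩ := hasSymmExpansion_of_odd hN
  have hcop (t : ℕ) {k : ℕ} (hk : k ∣ N) : (2 ^ t).Coprime k :=
    (Nat.coprime_two_left.2 (hN.of_dvd_nat hk)).pow_left t
  have hexp {w : ℤ} (hw : IsCoprime w N) (t : ℕ) :
      ∑ q ∈ N.divisorsAntidiagonal, (sqrtCount (2 ^ t * q.1) (w * q.2) : ℤ)
        = ∑ i, c i * (J(w * δ i | e i) * sqrtCount (2 ^ t) (w * δ i)) := by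
    simp only [← mul_assoc]
    rw [← hsum w (fun d => sqrtCount (2 ^ t) (w * d)) hw]
    · refine sum_congr rfl fun q hq => ?_
      rw [Nat.mem_divisorsAntidiagonal] at hq
      have hq1 : q.1 ∣ N := Dvd.intro _ hq.1
      rw [sqrtCount_mul (by positivity) (ne_zero_of_dvd_ne_zero hq.2 hq1) (hcop t hq1)]
      push_cast
      ring
    · intro k hk d
      push_cast
      rw [mul_left_comm, sqrtCount_sq_mul (by positivity)]
      exact (Nat.isCoprime_iff_coprime.2 (hcop t hk)).symm
  have hw (y : ℕ) : IsCoprime ((2 : ℤ) ^ y) N := by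
    exact_mod_cast Nat.isCoprime_iff_coprime.2 (hcop y dvd_rfl)
  have hodd (i : ι) : Odd (e i) ∧ Odd (δ i) :=
    ⟨hN.of_dvd_nat (hdvd i).1, hN.of_dvd_nat (hdvd i).2⟩
  zify
  rw [(hcop s dvd_rfl).sum_divisorsAntidiagonal_mul
      fun a d => (sqrtCount a d : ℤ) + sqrtCount a (-d),
    (hcop s dvd_rfl).sum_divisorsAntidiagonal_mul fun a d => (sqrtCount (4 * a) d : ℤ),
    Nat.prime_two.sum_divisorsAntidiagonal_pow s fun a d => ∑ r ∈ N.divisorsAntidiagonal,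
      ((sqrtCount (a * r.1) (d * r.2 : ℕ) : ℤ) + sqrtCount (a * r.1) (-(d * r.2 : ℕ))),
    Nat.prime_two.sum_divisorsAntidiagonal_pow s fun a d => ∑ r ∈ N.divisorsAntidiagonal,
      (sqrtCount (4 * (a * r.1)) (d * r.2 : ℕ) : ℤ)]
  have h4 (x r : ℕ) : 4 * (2 ^ x * r) = 2 ^ (x + 2) * r := by ring
  push_cast
  simp only [h4, sum_add_distrib, ← neg_mul, hexp (hw _), hexp (hw _).neg_left]
  rw [← sum_add_distrib]
  simp only [← sum_add_distrib, ← mul_add]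
  rw [sum_comm, sum_comm (s := antidiagonal s)]
  simp only [← mul_sum]
  simp only [sum_sqrtCount_two_pow_reflection (hodd _).1 (hodd _).2]
  rw [← Equiv.sum_comp σ]
  simp only [hσ]

theorem superdisc_eq_of_quadEquiv {p q : ℤ × ℤ × ℤ} (h : quadEquiv p q) :
    superdisc q = superdisc p := by
  obtain ⟨t, rfl⟩ := h
  simp only [superdisc]
  ring

/-- Every class of quadratics has exactly one representative with `0 ≤ b < 2|a|`. -/
theorem quadCount_eq_ncard {n : ℤ} (hn : n ≠ 0) (P : ℤ × ℤ × ℤ → Prop)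
    (hP : ∀ p q, quadEquiv p q → P p → P q) :
    quadCount n P
      = {p : ℤ × ℤ × ℤ | (superdisc p = n ∧ P p) ∧ 0 ≤ p.2.1 ∧ p.2.1 < 2 * |p.1|}.ncard := by
  have ha {p : ℤ × ℤ × ℤ} (hp : superdisc p = n) : p.1 ≠ 0 := by
    intro h
    simp only [superdisc, h, zero_mul] at hp
    exact hn hp.symm
  rw [quadCount, ← Nat.card_coe_set_eq]
  symm
  let S := {p : ℤ × ℤ × ℤ // superdisc p = n ∧ P p}
  have hinv (p q : S) (h : quadEquiv p.1 q.1) :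
      (p.1.1, p.1.2.1 % (2 * p.1.1)) = (q.1.1, q.1.2.1 % (2 * q.1.1)) := by
    obtain ⟨t, ht⟩ := h
    simp [ht]
  refine Nat.card_eq_of_bijective (fun p => Quot.mk _ ⟨p.1, p.2.1⟩) ⟨?_, ?_⟩
  · rintro ⟨⟨a, b, c⟩, ⟨h1, _⟩, hb, hb'⟩ ⟨⟨a', b', c'⟩, ⟨h1', _⟩, hd, hd'⟩ h
    have key := congrArg (Quot.lift (fun p : S => (p.1.1, p.1.2.1 % (2 * p.1.1))) hinv) h
    have ha0 : a ≠ 0 := ha h1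
    simp only [Prod.mk.injEq] at key hb hb' hd hd' h1 h1'
    obtain ⟨rfl, h2⟩ := key
    have habs : 2 * |a| = |2 * a| := by rw [abs_mul, abs_two]
    have hbb : b = b' := by
      rw [← Int.emod_abs b, ← Int.emod_abs b', ← habs] at h2
      rwa [Int.emod_eq_of_lt hb hb', Int.emod_eq_of_lt hd hd'] at h2
    subst hbb
    have hcc : c = c' := by
      simp only [superdisc] at h1 h1'
      have := mul_left_cancel₀ ha0 (h1.trans h1'.symm)
      have : 4 * a * c = 4 * a * c' := by linear_combination -this
      exact mul_left_cancel₀ (mul_ne_zero four_ne_zero ha0) this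
    subst hcc
    rfl
  · rintro ⟨p, hp, hPp⟩
    have ha0 := ha hp
    let t := -(p.2.1 / (2 * p.1))
    let q : ℤ × ℤ × ℤ := (p.1, p.2.1 + 2 * p.1 * t, p.1 * t ^ 2 + p.2.1 * t + p.2.2)
    have hpq : quadEquiv p q := ⟨t, rfl⟩
    have hq : p.2.1 + 2 * p.1 * t = p.2.1 % (2 * p.1) := by
      rw [Int.emod_def]
      ring
    have hqP : superdisc q = n ∧ P q :=
      ⟨(superdisc_eq_of_quadEquiv hpq).trans hp, hP p q hpq hPp⟩
    refine ⟨⟨q, hqP, ?_, ?_⟩, (Quot.sound (r := fun p q : S => quadEquiv p.1 q.1)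
      (a := ⟨p, hp, hPp⟩) (b := ⟨q, hqP⟩) hpq).symm⟩
    · change 0 ≤ p.2.1 + 2 * p.1 * t
      rw [hq]
      exact Int.emod_nonneg _ (mul_ne_zero two_ne_zero ha0)
    · change p.2.1 + 2 * p.1 * t < 2 * |p.1|
      rw [hq, show 2 * |p.1| = |2 * p.1| by rw [abs_mul, abs_two]]
      exact Int.emod_lt_abs _ (mul_ne_zero two_ne_zero ha0)

/-- Triples `(a, b, c)` with `a * (b² - k a c) = n`, prescribed signs of `b² - k a c` and
`0 ≤ b < K|a|`, counted by square roots modulo `k|a|`. -/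
theorem ncard_reduced_quadratics {n : ℤ} (hn : n ≠ 0) {k : ℕ} (hk : k ≠ 0) (K : ℕ) {E : Finset ℤ}
    (hE : ∀ ε ∈ E, ε = 1 ∨ ε = -1) :
    {p : ℤ × ℤ × ℤ | p.1 * (p.2.1 ^ 2 - k * p.1 * p.2.2) = n ∧
      (p.2.1 ^ 2 - k * p.1 * p.2.2).sign ∈ E ∧ 0 ≤ p.2.1 ∧ p.2.1 < K * |p.1|}.ncard
    = ∑ x ∈ E ×ˢ n.natAbs.divisorsAntidiagonal,
        #{b ∈ range (K * x.2.1) | ((k * x.2.1 : ℕ) : ℤ) ∣ ((b : ℕ) : ℤ) ^ 2 - x.1 * x.2.2} := by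
  have hkz : (k : ℤ) ≠ 0 := by exact_mod_cast hk
  have hσ : n.sign * n.natAbs = n := Int.sign_mul_natAbs n
  have hσ0 : n.sign ≠ 0 := by rwa [Ne, Int.sign_eq_zero_iff_zero]
  have hσ1 : n.sign = 1 ∨ n.sign = -1 := by
    rcases lt_or_gt_of_ne hn with h | h
    · exact Or.inr (Int.sign_eq_neg_one_of_neg h)
    · exact Or.inl (Int.sign_eq_one_of_pos h)
  have hsgn {ε : ℤ} (hε : ε = 1 ∨ ε = -1) : ε * ε = 1 := by rcases hε with rfl | rfl <;> rfl
  rw [← card_sigma, ← Set.ncard_coe_finset]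
  let g : (Σ _ : ℤ × ℕ × ℕ, ℕ) → ℤ × ℤ × ℤ := fun y =>
    (y.1.1 * n.sign * y.1.2.1, y.2,
      ((y.2 : ℤ) ^ 2 - y.1.1 * y.1.2.2) / (k * (y.1.1 * n.sign * y.1.2.1)))
  rw [← Set.InjOn.ncard_image (f := g)]
  · congr 1
    ext ⟨a, b, c⟩
    simp only [Set.mem_ofPred_eq, Set.mem_image, coe_sigma, Set.mem_sigma_iff, mem_coe, mem_product,
      Nat.mem_divisorsAntidiagonal, mem_filter, mem_range]
    constructor
    · rintro ⟨h1, h2, h3, h4⟩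
      set D := b ^ 2 - k * a * c with hD
      have ha0 : a ≠ 0 := left_ne_zero_of_mul (h1 ▸ hn)
      have hDabs : D.sign * |D| = D := by rw [Int.sign_mul_abs]
      have haabs : D.sign * n.sign * |a| = a := by
        rw [← h1, Int.sign_mul, mul_left_comm, hsgn (hE _ h2), mul_one, Int.sign_mul_abs]
      refine ⟨⟨(D.sign, a.natAbs, D.natAbs), b.toNat⟩, ⟨⟨h2, ?_, ?_⟩, ?_, ?_⟩, ?_⟩
      · rw [← h1, Int.natAbs_mul]
      · rwa [Ne, Int.natAbs_eq_zero]
      · zify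
        rwa [Int.toNat_of_nonneg h3]
      · push_cast
        rw [Int.toNat_of_nonneg h3, hDabs, hD, sub_sub_cancel]
        exact (mul_dvd_mul_left _ ((abs_dvd a a).2 dvd_rfl)).mul_right c
      · simp only [g]
        rw [Int.toNat_of_nonneg h3]
        push_cast
        rw [hDabs, haabs, hD, show b ^ 2 - (b ^ 2 - k * a * c) = k * a * c by ring,
          Int.mul_ediv_cancel_left _ (mul_ne_zero hkz ha0)]
    · rintro ⟨⟨⟨ε, α, δ⟩, x⟩, ⟨⟨h1, h2, h3⟩, h4, t, h5⟩, h6⟩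
      simp only [g, Prod.mk.injEq] at h1 h2 h3 h4 h5 h6
      have hε := hsgn (hE ε h1)
      have hs := hsgn hσ1
      obtain ⟨rfl, rfl, h6⟩ := h6
      have hα : α ≠ 0 := by
        rintro rfl
        simp [← h2] at h3
      have hδ : δ ≠ 0 := by
        rintro rfl
        simp [← h2] at h3
      have hαz : (α : ℤ) ≠ 0 := by exact_mod_cast hα
      have hden : (k : ℤ) * (ε * n.sign * α) ≠ 0 :=
        mul_ne_zero hkz (mul_ne_zero (mul_ne_zero (left_ne_zero_of_mul (hε ▸ one_ne_zero)) hσ0) hαz)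
      have hc : c = ε * n.sign * t := by
        rw [← h6, h5]
        refine Int.ediv_eq_of_eq_mul_right hden ?_
        push_cast
        linear_combination (-(k * α * t : ℤ)) * (n.sign * n.sign * hε + hs)
      have hD : (x : ℤ) ^ 2 - k * (ε * n.sign * α) * c = ε * δ := by
        push_cast at h5
        rw [hc]
        linear_combination h5 - (k * α * t : ℤ) * (n.sign * n.sign * hε + hs)
      rw [hD]
      have h2' : (α : ℤ) * δ = n.natAbs := by exact_mod_cast h2
      have hδs : (δ : ℤ).sign = 1 := Int.sign_eq_one_of_pos (by exact_mod_cast Nat.pos_of_ne_zero hδ)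
      have habs : |ε * n.sign * α| = α := by
        rw [abs_mul, abs_mul, Nat.abs_cast]
        rcases hE ε h1 with h | h <;> rcases hσ1 with h' | h' <;> simp [h, h']
      refine ⟨?_, ?_, by positivity, ?_⟩
      · linear_combination (n.sign * α * δ) * hε + n.sign * h2' + hσ
      · rw [Int.sign_mul, hδs, mul_one]
        rcases hE ε h1 with rfl | rfl <;> simpa using h1
      · rw [habs]
        exact_mod_cast h4
  · rintro ⟨⟨ε, α, δ⟩, x⟩ hx ⟨⟨ε', α', δ'⟩, x'⟩ hx' h
    simp only [coe_sigma, Set.mem_sigma_iff, mem_coe, mem_product,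
      Nat.mem_divisorsAntidiagonal] at hx hx'
    simp only [g, Prod.mk.injEq, Nat.cast_inj] at h
    obtain ⟨h1, rfl, -⟩ := h
    obtain ⟨⟨hε, h2, h3⟩, -⟩ := hx
    obtain ⟨⟨hε', h2', -⟩, -⟩ := hx'
    have hα : α ≠ 0 := by
      rintro rfl
      simp [← h2] at h3
    have habs : α = α' := by
      have := congrArg Int.natAbs h1
      have h' : n.sign.natAbs = 1 := by rcases hσ1 with h' | h' <;> simp [h']
      have hε1 {ε : ℤ} (h : ε ∈ E) : ε.natAbs = 1 := by rcases hE ε h with rfl | rfl <;> rfl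
      simpa [Int.natAbs_mul, h', hε1 hε, hε1 hε'] using this
    subst habs
    obtain rfl : δ = δ' := Nat.eq_of_mul_eq_mul_left (Nat.pos_of_ne_zero hα) (h2.trans h2'.symm)
    rw [mul_assoc, mul_assoc, mul_left_inj' (mul_ne_zero hσ0 (by exact_mod_cast hα))] at h1
    rw [h1]

theorem quadCount_even_eq_sum {n : ℤ} (hn : n ≠ 0) :
    quadCount (4 * n) (fun p => 2 ∣ p.2.1) = ∑ q ∈ n.natAbs.divisorsAntidiagonal,
      (sqrtCount q.1 q.2 + sqrtCount q.1 (-q.2)) := by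
  have h := ncard_reduced_quadratics hn one_ne_zero 1 (E := {1, -1}) (by simp)
  rw [sum_product, sum_pair (by norm_num), ← sum_add_distrib] at h
  simp only [one_mul, neg_one_mul, Nat.cast_one] at h
  simp only [sqrtCount, ← h]
  rw [quadCount_eq_ncard (mul_ne_zero four_ne_zero hn)]
  · have hinj : Function.Injective fun p : ℤ × ℤ × ℤ => (p.1, 2 * p.2.1, p.2.2) := by
      rintro ⟨a, b, c⟩ ⟨a', b', c'⟩ h
      simpa using h
    refine Eq.trans ?_ (Set.ncard_image_of_injective _ hinj)
    congr 1
    ext ⟨a, b, c⟩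
    simp only [superdisc, Set.mem_ofPred_eq, Set.mem_image, Prod.mk.injEq]
    constructor
    · rintro ⟨⟨h1, b, rfl⟩, h2, h3⟩
      have h1' : a * (b ^ 2 - a * c) = n := by linarith
      refine ⟨(a, b, c), ⟨h1', ?_, by simpa using h2, by simpa using h3⟩, rfl, rfl, rfl⟩
      have hD : b ^ 2 - a * c ≠ 0 := right_ne_zero_of_mul (h1' ▸ hn)
      rcases lt_or_gt_of_ne hD with h | h
      · simp [Int.sign_eq_neg_one_of_neg h]
      · simp [Int.sign_eq_one_of_pos h]
    · rintro ⟨⟨a, b, c⟩, ⟨h1, -, h2, h3⟩, rfl, rfl, rfl⟩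
      exact ⟨⟨by linear_combination 4 * h1, dvd_mul_right _ _⟩, by simpa using h2,
        by simpa using h3⟩
  · rintro p _ ⟨t, rfl⟩ h
    exact dvd_add h ⟨p.1 * t, by ring⟩

theorem two_mul_quadCount_pos_eq_sum {n : ℤ} (hn : n ≠ 0) :
    2 * quadCount n (fun p => 0 < p.2.1 ^ 2 - 4 * p.1 * p.2.2)
      = ∑ q ∈ n.natAbs.divisorsAntidiagonal, sqrtCount (4 * q.1) q.2 := by
  have h := ncard_reduced_quadratics hn four_ne_zero 2 (E := {1}) (by simp)
  rw [sum_product, sum_singleton] at h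
  simp only [sqrtCount_four_mul, ← mul_sum]
  push_cast at h
  simp only [one_mul] at h
  rw [← h, quadCount_eq_ncard hn]
  · congr 2
    ext p
    simp only [superdisc, Set.mem_ofPred_eq, mem_singleton, Int.sign_eq_one_iff_pos, and_assoc]
  · rintro p _ ⟨t, rfl⟩ h
    convert h using 1
    ring

/-- Quadratic Ohno–Nakagawa: `q₂(4n) = 2·q⁺(n)` for every nonzero integer `n`. -/
theorem quad_ON_second (n : ℤ) (hn : n ≠ 0) :
    quadCount (4 * n) (fun p => 2 ∣ p.2.1)
    = 2 * quadCount n (fun p => 0 < p.2.1 ^ 2 - 4 * p.1 * p.2.2) := by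
  rw [quadCount_even_eq_sum hn, two_mul_quadCount_pos_eq_sum hn,
    sum_sqrtCount_reflection (Int.natAbs_ne_zero.2 hn)]
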